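/- arXiv:1907.00210 — 2 statements merged into one kernel-verified Lean document; each statement's English description precedes it below -/
import Mathlib

section
/- Let Λ be an infinite connected graph that is (k+1)-path-colourable, and let p be an integer with 1 ≤ p ≤ k. Then Maker has a winning strategy in the (p,p)-percolation game on Λ, irrespective of the choice of the root. Moreover, Maker can forgo her first turn entirely and in addition ensure that every vertex of Λ (not merely the root) remains in an infinite component at all times during the game. -/
/-! ### Core definitions for the `(p,q)`-percolation game

Two players, Maker and Breaker, play in alternating turns on an infinite connected
graph `G` with root `v₀`, Maker playing first.  On each of her turns Maker marks `p`
as-yet-unclaimed edges as safe, while on each of his turns Breaker deletes `q`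
as-yet-unclaimed edges.  Breaker wins if at some time the connected component of `v₀`
(in `G` with Breaker's edges deleted) is finite; Maker wins if she can keep it
infinite forever. -/

namespace PercGame

/-- A positional strategy: given the sets of edges claimed so far by Maker and by
Breaker, produce the finite set of edges to claim next. -/
abbrev Strategy (V : Type) : Type := Finset (Sym2 V) → Finset (Sym2 V) → Finset (Sym2 V)

variable {V : Type} [DecidableEq V]

/-- Maker legally claims exactly `p` as-yet-unclaimed edges of `G` on each turn. -/
def MakerLegal (G : SimpleGraph V) (p : ℕ) (σ : Strategy V) : Prop :=
  ∀ M B : Finset (Sym2 V),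
    (σ M B).card = p ∧ ↑(σ M B) ⊆ G.edgeSet ∧ Disjoint (σ M B) (M ∪ B)

/-- Breaker legally deletes exactly `q` as-yet-unclaimed edges of `G` on each turn. -/
def BreakerLegal (G : SimpleGraph V) (q : ℕ) (τ : Strategy V) : Prop :=
  ∀ M B : Finset (Sym2 V),
    (τ M B).card = q ∧ ↑(τ M B) ⊆ G.edgeSet ∧ Disjoint (τ M B) (M ∪ B)

/-- The position (Maker's safe edges, Breaker's deleted edges) after `n` full rounds of
play starting from the position `init`; Maker moves first in every round. -/
def play (σ τ : Strategy V) (init : Finset (Sym2 V) × Finset (Sym2 V)) :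
    ℕ → Finset (Sym2 V) × Finset (Sym2 V)
  | 0 => init
  | n + 1 =>
    let P := play σ τ init n
    let M := P.1 ∪ σ P.1 P.2
    (M, P.2 ∪ τ M P.2)

/-- The vertex set of the connected component of `v₀` in `G` after deleting the edges
in `B`. -/
def comp (G : SimpleGraph V) (v₀ : V) (B : Finset (Sym2 V)) : Set V :=
  {w : V | (G.deleteEdges (↑B : Set (Sym2 V))).Reachable v₀ w}

/-- Maker has a winning strategy in the `(p,q)`-percolation game on `(G, v₀)`:
she can ensure that `v₀` lies in an infinite component at all times. -/
def MakerWins (G : SimpleGraph V) (v₀ : V) (p q : ℕ) : Prop :=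
  ∃ σ : Strategy V, MakerLegal G p σ ∧
    ∀ τ : Strategy V, BreakerLegal G q τ →
      ∀ n : ℕ, (comp G v₀ (play σ τ (∅, ∅) n).2).Infinite

/-- Breaker has a winning strategy in the `(p,q)`-percolation game on `(G, v₀)`:
he can ensure that at some time the component of `v₀` becomes finite. -/
def BreakerWins (G : SimpleGraph V) (v₀ : V) (p q : ℕ) : Prop :=
  ∃ τ : Strategy V, BreakerLegal G q τ ∧
    ∀ σ : Strategy V, MakerLegal G p σ →
      ∃ n : ℕ, (comp G v₀ (play σ τ (∅, ∅) n).2).Finite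

end PercGame

/-- A `k`-colouring `c` of the edges of `G` is a `k`-path-colouring if for every vertex
`v` and every colour `i` there is an infinite (self-avoiding) path through `v` all of
whose edges have colour `i`. -/
def SimpleGraph.IsPathColouring {V : Type} (G : SimpleGraph V) (k : ℕ)
    (c : Sym2 V → Fin k) : Prop :=
  ∀ (v : V) (i : Fin k), ∃ f : ℕ → V, Function.Injective f ∧ f 0 = v ∧
    ∀ n : ℕ, G.Adj (f n) (f (n + 1)) ∧ c s(f n, f (n + 1)) = i

/-- The position after `n` full rounds of a `(p,q)`-percolation game in which **Maker
forgoes her first turn**, i.e. Breaker moves first in every round and Maker responds. -/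
def PercGame.playBreakerFirst {V : Type} [DecidableEq V] (σ τ : PercGame.Strategy V)
    (init : Finset (Sym2 V) × Finset (Sym2 V)) :
    ℕ → Finset (Sym2 V) × Finset (Sym2 V)
  | 0 => init
  | n + 1 =>
    let P := PercGame.playBreakerFirst σ τ init n
    let B := P.2 ∪ τ P.1 P.2
    (P.1 ∪ σ P.1 B, B)

namespace SimpleGraph

variable {V : Type}

/-- Every vertex lies in an infinite component of `H` or in the component of a vertex of `D`. -/
def InfiniteUpTo (H : SimpleGraph V) (D : Set V) : Prop :=
  ∀ v, {w | H.Reachable v w}.Infinite ∨ ∃ d ∈ D, H.Reachable v d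

theorem infinite_reachable_mono {H H' : SimpleGraph V} (h : H ≤ H') {v : V}
    (hv : {w | H.Reachable v w}.Infinite) : {w | H'.Reachable v w}.Infinite :=
  hv.mono fun _ hw => hw.mono h

theorem infinite_reachable_congr {H : SimpleGraph V} {v w : V} (h : H.Reachable v w)
    (hw : {x | H.Reachable w x}.Infinite) : {x | H.Reachable v x}.Infinite :=
  hw.mono fun _ hx => h.trans hx

theorem InfiniteUpTo.mono {H H' : SimpleGraph V} {D D' : Set V} (h : H.InfiniteUpTo D)
    (hH : H ≤ H') (hD : D ⊆ D') : H'.InfiniteUpTo D' := fun v =>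
  (h v).imp (infinite_reachable_mono hH) fun ⟨d, hd, hvd⟩ => ⟨d, hD hd, hvd.mono hH⟩

theorem reachable_deleteEdges_singleton_or {H : SimpleGraph V} (a b : V) {v w : V}
    (h : H.Reachable v w) :
    (H.deleteEdges {s(a, b)}).Reachable v w ∨ (H.deleteEdges {s(a, b)}).Reachable v a ∨
      (H.deleteEdges {s(a, b)}).Reachable v b := by
  obtain ⟨p⟩ := h
  induction p with
  | nil => exact Or.inl .rfl
  | @cons u x y hux _ ih =>
    by_cases he : s(u, x) = s(a, b)
    · rcases Sym2.eq_iff.1 he with ⟨rfl, -⟩ | ⟨rfl, -⟩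
      · exact Or.inr (Or.inl .rfl)
      · exact Or.inr (Or.inr .rfl)
    · have hr : (H.deleteEdges {s(a, b)}).Reachable u x :=
        Adj.reachable (deleteEdges_adj.2 ⟨hux, he⟩)
      exact ih.imp hr.trans (Or.imp hr.trans hr.trans)

/-- Deleting one edge creates at most one new finite component. -/
theorem InfiniteUpTo.deleteEdges_singleton {H : SimpleGraph V} {D : Set V}
    (h : H.InfiniteUpTo D) (e : Sym2 V) :
    ∃ x, (H.deleteEdges {e}).InfiniteUpTo (insert x D) := by
  induction e with | _ a b
  set H' := H.deleteEdges {s(a, b)} with hH'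
  suffices key : ∃ x y, (∀ v, H'.Reachable v a ∨ H'.Reachable v b →
      H'.Reachable v x ∨ H'.Reachable v y) ∧
      ({w | H'.Reachable y w}.Infinite ∨ (∃ d ∈ D, H'.Reachable y d)) by
    obtain ⟨x, y, hxy, hy⟩ := key
    have hend : ∀ v, H'.Reachable v a ∨ H'.Reachable v b →
        {w | H'.Reachable v w}.Infinite ∨ ∃ d ∈ insert x D, H'.Reachable v d := by
      intro v hv
      rcases hxy v hv with hvx | hvy
      · exact Or.inr ⟨x, Set.mem_insert _ _, hvx⟩
      · exact hy.imp (infinite_reachable_congr hvy)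
          fun ⟨d, hd, hyd⟩ => ⟨d, Set.mem_insert_of_mem _ hd, hvy.trans hyd⟩
    refine ⟨x, fun v => ?_⟩
    by_cases hv : H'.Reachable v a ∨ H'.Reachable v b
    · exact hend v hv
    · have hsame : ∀ w, H.Reachable v w → H'.Reachable v w := fun w hw =>
        (reachable_deleteEdges_singleton_or a b hw).resolve_right hv
      exact (h v).imp (fun hi => hi.mono hsame)
        fun ⟨d, hd, hvd⟩ => ⟨d, Set.mem_insert_of_mem _ hd, hsame d hvd⟩
  have hswap : ∀ v, H'.Reachable v a ∨ H'.Reachable v b →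
      H'.Reachable v b ∨ H'.Reachable v a := fun v => Or.symm
  rcases h a with hinf | ⟨d, hd, had⟩
  · by_cases ha : {w | H'.Reachable a w}.Infinite
    · exact ⟨b, a, hswap, Or.inl ha⟩
    · refine ⟨a, b, fun v => id, Or.inl fun hb => hinf ?_⟩
      refine ((Set.not_infinite.1 ha).union hb).subset fun w hw => ?_
      rcases reachable_deleteEdges_singleton_or a b hw.symm with h1 | h1 | h1
      · exact Or.inl h1.symm
      · exact Or.inl h1.symm
      · exact Or.inr h1.symm
  · rcases reachable_deleteEdges_singleton_or a b had.symm with h1 | h1 | h1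
    · exact ⟨b, a, hswap, Or.inr ⟨d, hd, h1.symm⟩⟩
    · exact ⟨b, a, hswap, Or.inr ⟨d, hd, h1.symm⟩⟩
    · exact ⟨a, b, fun v => id, Or.inr ⟨d, hd, h1.symm⟩⟩

/-- Adding an edge that leaves the component of `d` makes `d` redundant. -/
theorem InfiniteUpTo.of_adj {H H' : SimpleGraph V} {D : Set V} {d x y : V}
    (h : H.InfiniteUpTo (insert d D)) (hH : H ≤ H') (hdx : H.Reachable d x)
    (hdy : ¬ H.Reachable d y) (hxy : H'.Adj x y) : H'.InfiniteUpTo D := by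
  intro v
  rcases h v with hv | ⟨d', rfl | hd', hvd⟩
  · exact Or.inl (infinite_reachable_mono hH hv)
  · have hvy : H'.Reachable v y := ((hvd.trans hdx).mono hH).trans hxy.reachable
    rcases h y with hy | ⟨d'', rfl | hd'', hyd⟩
    · exact Or.inl (infinite_reachable_congr hvy (infinite_reachable_mono hH hy))
    · exact absurd hyd.symm hdy
    · exact Or.inr ⟨d'', hd'', hvy.trans (hyd.mono hH)⟩
  · exact Or.inr ⟨d', hd', hvd.mono hH⟩

/-- A vertex with an infinite component can be dropped from `D`. -/
theorem InfiniteUpTo.of_infinite {H : SimpleGraph V} {D : Set V} {d : V}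
    (h : H.InfiniteUpTo (insert d D)) (hd : {w | H.Reachable d w}.Infinite) :
    H.InfiniteUpTo D := by
  intro v
  rcases h v with hv | ⟨d', rfl | hd', hvd⟩
  · exact Or.inl hv
  · exact Or.inl (infinite_reachable_congr hvd hd)
  · exact Or.inr ⟨d', hd', hvd⟩

/-- A finite vertex set containing `v` is left by an edge of any graph in which the component of
`v` is infinite. -/
theorem exists_adj_leaving {H : SimpleGraph V} {A : Set V} (hA : A.Finite) {v : V} (hv : v ∈ A)
    (hinf : {w | H.Reachable v w}.Infinite) : ∃ x y, x ∈ A ∧ y ∉ A ∧ H.Adj x y := by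
  by_contra! hcl
  refine hinf (hA.subset ?_)
  rintro w ⟨p⟩
  induction p with
  | nil => exact hv
  | @cons u x y hux _ ih =>
    have hx : x ∈ A := by
      by_contra hx
      exact hcl u x hv hx hux
    exact ih hx (infinite_reachable_congr hux.symm.reachable hinf)

end SimpleGraph

namespace PercGame

open SimpleGraph

variable {V I : Type}

/-- The graph of Maker's edges together with the edges of colour `i` not deleted by Breaker. -/
def colourGraph (G : SimpleGraph V) (c : Sym2 V → I) (M B : Finset (Sym2 V)) (i : I) :
    SimpleGraph V :=
  fromEdgeSet ({e | e ∈ M} ∪ {e | e ∈ G.edgeSet ∧ c e = i ∧ e ∉ B})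

theorem colourGraph_adj {G : SimpleGraph V} {c : Sym2 V → I} {M B : Finset (Sym2 V)} {i : I}
    {x y : V} : (colourGraph G c M B i).Adj x y ↔
      (s(x, y) ∈ M ∨ (G.Adj x y ∧ c s(x, y) = i ∧ s(x, y) ∉ B)) ∧ x ≠ y := by
  simp only [colourGraph, fromEdgeSet_adj, Set.mem_union, Set.mem_ofPred_eq, mem_edgeSet, ne_eq]

theorem colourGraph_mono {G : SimpleGraph V} {c : Sym2 V → I} {M M' B : Finset (Sym2 V)}
    (h : M ⊆ M') (i : I) : colourGraph G c M B i ≤ colourGraph G c M' B i := by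
  intro x y hxy
  rw [colourGraph_adj] at hxy ⊢
  exact ⟨hxy.1.imp_left (@h _), hxy.2⟩

/-- In colour `i`, a component may be finite only if it contains some `d` with `(i, d) ∈ D`. -/
def AlmostGood (G : SimpleGraph V) (c : Sym2 V → I) (M B : Finset (Sym2 V))
    (D : Finset (I × V)) : Prop :=
  ∀ i, (colourGraph G c M B i).InfiniteUpTo {d | (i, d) ∈ D}

/-- Positions in which every vertex has an infinite component in Maker's edges together with the
remaining edges of any given colour. -/
structure Good (G : SimpleGraph V) (c : Sym2 V → I) (M B : Finset (Sym2 V)) : Prop where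
  subset : (M : Set (Sym2 V)) ⊆ G.edgeSet
  disjoint : Disjoint M B
  infinite : AlmostGood G c M B ∅

theorem Good.infinite_comp [Nonempty I] {G : SimpleGraph V} {c : Sym2 V → I}
    {M B : Finset (Sym2 V)} (h : Good G c M B) (v : V) : (comp G v B).Infinite := by
  obtain ⟨i⟩ := ‹Nonempty I›
  have hv : {w | (colourGraph G c M B i).Reachable v w}.Infinite :=
    (h.infinite i v).resolve_right (by simp)
  refine infinite_reachable_mono (fun x y hxy => ?_) hv
  rw [colourGraph_adj] at hxy
  rw [deleteEdges_adj]
  rcases hxy.1 with hM | ⟨hG, -, hB⟩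
  · exact ⟨h.subset hM, fun hB => Finset.disjoint_left.1 h.disjoint hM hB⟩
  · exact ⟨hG, hB⟩

theorem exists_legal_move {G : SimpleGraph V} (hE : G.edgeSet.Infinite) (X : Finset (Sym2 V))
    (n : ℕ) : ∃ S : Finset (Sym2 V), S.card = n ∧ (S : Set (Sym2 V)) ⊆ G.edgeSet ∧
      Disjoint S X := by
  obtain ⟨S, hS, hn⟩ := (hE.sdiff X.finite_toSet).exists_subset_card_eq n
  exact ⟨S, hn, fun e he => (hS he).1, Finset.disjoint_left.2 fun e he => (hS he).2⟩

variable [DecidableEq V]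

theorem AlmostGood.delete [DecidableEq I] {G : SimpleGraph V} {c : Sym2 V → I}
    {M B : Finset (Sym2 V)} (h : AlmostGood G c M B ∅) (T : Finset (Sym2 V)) :
    ∃ D : Finset (I × V), D.card ≤ T.card ∧ (∀ x ∈ D, x.1 ∈ T.image c) ∧
      AlmostGood G c M (B ∪ T) D := by
  induction T using Finset.induction with
  | empty => exact ⟨∅, by simp, by simp, by simpa using h⟩
  | insert e T he ih =>
    obtain ⟨D, hcard, hcol, hD⟩ := ih
    obtain ⟨x, hx⟩ := (hD (c e)).deleteEdges_singleton e
    refine ⟨insert (c e, x) D, ?_, ?_, fun i => ?_⟩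
    · rw [Finset.card_insert_of_notMem he]
      exact (Finset.card_insert_le _ _).trans (by omega)
    · intro z hz
      rcases Finset.mem_insert.1 hz with rfl | hz
      · simp
      · rw [Finset.image_insert]
        exact Finset.mem_insert_of_mem (hcol z hz)
    · by_cases hi : i = c e
      · subst hi
        refine hx.mono (fun u v huv => ?_) (fun d hd => ?_)
        · rw [deleteEdges_adj, colourGraph_adj] at huv
          rw [colourGraph_adj]
          simp only [Finset.mem_union, Finset.mem_insert, Set.mem_singleton_iff] at huv ⊢
          tauto
        · simp only [Set.mem_insert_iff, Set.mem_ofPred_eq, Finset.mem_insert] at hd ⊢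
          exact hd.imp_left fun h => by rw [h]
      · refine (hD i).mono (fun u v huv => ?_) (fun d hd => Finset.mem_insert_of_mem hd)
        rw [colourGraph_adj] at huv ⊢
        refine ⟨huv.1.imp_right fun ⟨h1, h2, h3⟩ => ⟨h1, h2, fun h4 => ?_⟩, huv.2⟩
        simp only [Finset.mem_union, Finset.mem_insert] at h3 h4
        rcases h4 with h4 | rfl | h4
        · exact h3 (Or.inl h4)
        · exact hi h2.symm
        · exact h3 (Or.inr h4)

theorem AlmostGood.repair [DecidableEq I] {G : SimpleGraph V} {c : Sym2 V → I}
    {B : Finset (Sym2 V)} {j : I} (D : Finset (I × V)) (hj : ∀ x ∈ D, x.1 ≠ j)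
    {M : Finset (Sym2 V)} (h : AlmostGood G c M B D) :
    ∃ S : Finset (Sym2 V), S.card ≤ D.card ∧ (S : Set (Sym2 V)) ⊆ G.edgeSet ∧
      Disjoint S (M ∪ B) ∧ AlmostGood G c (M ∪ S) B ∅ := by
  induction D using Finset.induction generalizing M with
  | empty => exact ⟨∅, by simp, by simp, by simp, by simpa using h⟩
  | insert z D hz ih =>
    obtain ⟨i, d⟩ := z
    have hij : i ≠ j := hj (i, d) (Finset.mem_insert_self _ _)
    have hjD : ∀ x ∈ D, x.1 ≠ j := fun x hx => hj x (Finset.mem_insert_of_mem hx)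
    have hcard := Finset.card_insert_of_notMem hz
    have hset : {d' | (i, d') ∈ insert (i, d) D} = insert d {d' | (i, d') ∈ D} := by
      ext d'; simp
    have hother : ∀ i', i' ≠ i →
        {d' | (i', d') ∈ insert (i, d) D} = {d' | (i', d') ∈ D} := by
      intro i' hi'; ext d'; simp [hi']
    have hi := h i
    rw [hset] at hi
    by_cases hd : {w | (colourGraph G c M B i).Reachable d w}.Infinite
    · obtain ⟨S, hS, hS'⟩ := ih hjD (M := M) (fun i' => by
        by_cases hi' : i' = i
        · subst hi'; exact hi.of_infinite hd
        · rw [← hother i' hi']; exact h i')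
      exact ⟨S, by omega, hS'⟩
    · have hjinf : {w | (colourGraph G c M B j).Reachable d w}.Infinite := by
        refine (h j d).resolve_right ?_
        rintro ⟨d', hd', -⟩
        exact hj _ hd' rfl
      obtain ⟨x, y, hx, hy, hxy⟩ :=
        exists_adj_leaving (Set.not_infinite.1 hd) (Reachable.refl d) hjinf
      have hxM : s(x, y) ∉ M := fun hM =>
        hy (hx.trans (Adj.reachable (colourGraph_adj.2 ⟨Or.inl hM, hxy.ne⟩)))
      obtain ⟨hG, -, hB⟩ := (colourGraph_adj.1 hxy).1.resolve_left hxM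
      have hsub : M ⊆ insert s(x, y) M := Finset.subset_insert _ _
      obtain ⟨S, hS, hSE, hSd, hSg⟩ := ih hjD (M := insert s(x, y) M) (fun i' => by
        by_cases hi' : i' = i
        · subst hi'
          exact hi.of_adj (colourGraph_mono hsub _) hx hy
            (colourGraph_adj.2 ⟨Or.inl (Finset.mem_insert_self _ _), hxy.ne⟩)
        · rw [← hother i' hi']
          exact (h i').mono (colourGraph_mono hsub _) subset_rfl)
      refine ⟨insert s(x, y) S, (Finset.card_insert_le _ _).trans (by omega), ?_, ?_, ?_⟩
      · rw [Finset.coe_insert]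
        exact Set.insert_subset hG hSE
      · rw [Finset.disjoint_insert_left]
        refine ⟨by simp [hxM, hB], hSd.mono_right ?_⟩
        exact Finset.union_subset_union_left hsub
      · rwa [Finset.union_insert, ← Finset.insert_union]

/-- Maker can answer the deletion of fewer edges than there are colours. -/
theorem Good.exists_response [Fintype I] [DecidableEq I] {G : SimpleGraph V} {c : Sym2 V → I}
    (hE : G.edgeSet.Infinite) {p : ℕ} (hp : p < Fintype.card I) {M B T : Finset (Sym2 V)}
    (h : Good G c M B) (hT : T.card ≤ p) (hMT : Disjoint T M) :
    ∃ S : Finset (Sym2 V), S.card = p ∧ (S : Set (Sym2 V)) ⊆ G.edgeSet ∧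
      Disjoint S (M ∪ (B ∪ T)) ∧ Good G c (M ∪ S) (B ∪ T) := by
  obtain ⟨D, hD, hDc, hDg⟩ := h.infinite.delete T
  obtain ⟨j, hj⟩ : ∃ j, j ∉ T.image c := by
    by_contra! hall
    have h1 : Fintype.card I ≤ (T.image c).card := by
      rw [Finset.eq_univ_iff_forall.2 hall, Finset.card_univ]
    have h2 : (T.image c).card ≤ T.card := Finset.card_image_le
    omega
  obtain ⟨S, hS, hSE, hSd, hSg⟩ :=
    hDg.repair D (j := j) fun x hx hxj => hj (hxj ▸ hDc x hx)
  obtain ⟨S', hS', hSE', hSd'⟩ := exists_legal_move hE (M ∪ (B ∪ T) ∪ S) (p - S.card)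
  rw [Finset.disjoint_union_right] at hSd'
  have hEu : ((S ∪ S' : Finset (Sym2 V)) : Set (Sym2 V)) ⊆ G.edgeSet := by
    rw [Finset.coe_union]
    exact Set.union_subset hSE hSE'
  have hdis : Disjoint (S ∪ S') (M ∪ (B ∪ T)) := Finset.disjoint_union_left.2 ⟨hSd, hSd'.1⟩
  refine ⟨S ∪ S', ?_, hEu, hdis, ?_, ?_, fun i => ?_⟩
  · rw [Finset.card_union_of_disjoint hSd'.2.symm]
    omega
  · rw [Finset.coe_union]
    exact Set.union_subset h.subset hEu
  · refine Finset.disjoint_union_left.2 ⟨?_, hdis.mono_right Finset.subset_union_right⟩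
    exact Finset.disjoint_union_right.2 ⟨h.disjoint, hMT.symm⟩
  · refine (hSg i).mono (colourGraph_mono ?_ i) subset_rfl
    exact Finset.union_subset_union_right Finset.subset_union_left

/-- Maker restores a good position whenever she can. -/
theorem exists_makerLegal_good {G : SimpleGraph V} (c : Sym2 V → I) (hE : G.edgeSet.Infinite)
    (p : ℕ) : ∃ σ : Strategy V, MakerLegal G p σ ∧ ∀ M B,
      (∃ S : Finset (Sym2 V), S.card = p ∧ (S : Set (Sym2 V)) ⊆ G.edgeSet ∧
        Disjoint S (M ∪ B) ∧ Good G c (M ∪ S) B) → Good G c (M ∪ σ M B) B := by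
  have key : ∀ M B : Finset (Sym2 V), ∃ S : Finset (Sym2 V),
      (S.card = p ∧ (S : Set (Sym2 V)) ⊆ G.edgeSet ∧ Disjoint S (M ∪ B)) ∧
      ((∃ S : Finset (Sym2 V), S.card = p ∧ (S : Set (Sym2 V)) ⊆ G.edgeSet ∧
        Disjoint S (M ∪ B) ∧ Good G c (M ∪ S) B) → Good G c (M ∪ S) B) := by
    intro M B
    by_cases h : ∃ S : Finset (Sym2 V), S.card = p ∧ (S : Set (Sym2 V)) ⊆ G.edgeSet ∧
        Disjoint S (M ∪ B) ∧ Good G c (M ∪ S) B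
    · obtain ⟨S, h1, h2, h3, h4⟩ := h
      exact ⟨S, ⟨h1, h2, h3⟩, fun _ => h4⟩
    · obtain ⟨S, hS⟩ := exists_legal_move hE (M ∪ B) p
      exact ⟨S, hS, fun h' => absurd h' h⟩
  choose σ hσ hσ' using key
  exact ⟨σ, hσ, hσ'⟩

end PercGame

namespace SimpleGraph

open PercGame

variable {V : Type} {G : SimpleGraph V} {k : ℕ} {c : Sym2 V → Fin (k + 1)}

theorem IsPathColouring.infinite_edgeSet [DecidableEq V] [Infinite V]
    (h : G.IsPathColouring (k + 1) c) : G.edgeSet.Infinite := by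
  intro hfin
  refine Set.infinite_univ (α := V)
    ((hfin.biUnion fun e _ => e.toFinset.finite_toSet).subset fun v _ => ?_)
  obtain ⟨f, -, rfl, hf⟩ := h v 0
  exact Set.mem_biUnion (x := s(f 0, f 1)) (hf 0).1 (by simp)

theorem IsPathColouring.good_empty [DecidableEq V] (h : G.IsPathColouring (k + 1) c) :
    Good G c ∅ ∅ := by
  refine ⟨by simp, by simp, fun i v => Or.inl ?_⟩
  obtain ⟨f, hinj, rfl, hf⟩ := h v i
  refine (Set.infinite_range_of_injective hinj).mono ?_
  rintro _ ⟨n, rfl⟩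
  induction n with
  | zero => exact Reachable.refl _
  | succ n ih =>
    refine Reachable.trans ih (Adj.reachable (colourGraph_adj.2 ⟨Or.inr ?_, (hf n).1.ne⟩))
    exact ⟨(hf n).1, (hf n).2, by simp⟩

end SimpleGraph

/-- **Theorem (path-colourable graphs).**
Let `Λ` be an infinite connected graph which is `(k+1)`-path-colourable, and let `p` be
an integer with `1 ≤ p ≤ k`.  Then Maker has a winning strategy in the
`(p,p)`-percolation game on `Λ`, irrespective of the choice of the root.  Moreover,
Maker can forgo her first turn entirely (letting Breaker move first in every round)
and in addition ensure that **every** vertex of `Λ` — not merely the root — remains in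
an infinite component at all times during the game. -/
theorem maker_wins_pp_on_path_colourable (k p : ℕ) (hp : 1 ≤ p) (hpk : p ≤ k)
    {V : Type} [DecidableEq V] (Λ : SimpleGraph V) [Infinite V] (hconn : Λ.Connected)
    (hcol : ∃ c : Sym2 V → Fin (k + 1), Λ.IsPathColouring (k + 1) c) :
    (∀ v₀ : V, PercGame.MakerWins Λ v₀ p p) ∧
    (∃ σ : PercGame.Strategy V, PercGame.MakerLegal Λ p σ ∧
      ∀ τ : PercGame.Strategy V, PercGame.BreakerLegal Λ p τ →
        ∀ (n : ℕ) (v : V),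
          (PercGame.comp Λ v (PercGame.playBreakerFirst σ τ (∅, ∅) n).2).Infinite) := by
  obtain ⟨c, hc⟩ := hcol
  have hE := hc.infinite_edgeSet
  have hcard : p < Fintype.card (Fin (k + 1)) := by simp; omega
  obtain ⟨σ, hσ, hgood⟩ := PercGame.exists_makerLegal_good c hE p
  refine ⟨fun v₀ => ⟨σ, hσ, fun τ hτ n => ?_⟩, σ, hσ, fun τ hτ n v => ?_⟩
  · have key : ∀ n, ∃ S : Finset (Sym2 V), S.card = p ∧ (S : Set (Sym2 V)) ⊆ Λ.edgeSet ∧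
        Disjoint S ((PercGame.play σ τ (∅, ∅) n).1 ∪ (PercGame.play σ τ (∅, ∅) n).2) ∧
        PercGame.Good Λ c ((PercGame.play σ τ (∅, ∅) n).1 ∪ S)
          (PercGame.play σ τ (∅, ∅) n).2 := by
      intro n
      induction n with
      | zero =>
        simpa [PercGame.play] using hc.good_empty.exists_response hE hcard (T := ∅)
          (by simp) (by simp)
      | succ n ih =>
        obtain ⟨hτc, -, hτd⟩ := hτ ((PercGame.play σ τ (∅, ∅) n).1 ∪
          σ (PercGame.play σ τ (∅, ∅) n).1 (PercGame.play σ τ (∅, ∅) n).2)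
          (PercGame.play σ τ (∅, ∅) n).2
        exact (hgood _ _ ih).exists_response hE hcard hτc.le
          (hτd.mono_right Finset.subset_union_left)
    obtain ⟨S, -, -, -, hS⟩ := key n
    exact hS.infinite_comp v₀
  · suffices key : PercGame.Good Λ c (PercGame.playBreakerFirst σ τ (∅, ∅) n).1
        (PercGame.playBreakerFirst σ τ (∅, ∅) n).2 from key.infinite_comp v
    induction n with
    | zero => exact hc.good_empty
    | succ n ih =>
      obtain ⟨hτc, -, hτd⟩ := hτ (PercGame.playBreakerFirst σ τ (∅, ∅) n).1
        (PercGame.playBreakerFirst σ τ (∅, ∅) n).2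
      exact hgood _ _ (ih.exists_response hE hcard hτc.le
        (hτd.mono_right Finset.subset_union_left))
end

section
/- Let q, M, N be positive integers with N ≥ 4(q+2)^M. Then BoxMaker has a winning strategy in the (q, M, N)-double-response box-game: she can guarantee that at some point she has claimed all M items from some box that BoxBreaker has not removed. -/
namespace BoxGame

/-- A BoxBreaker strategy: given the boxes removed so far and the items claimed so far,
the (nonempty, of size at most `q`) set of boxes to remove next. -/
abbrev BBStrategy (N M : ℕ) : Type :=
  Finset (Fin N) → Finset (Fin N × Fin M) → Finset (Fin N)

/-- A BoxMaker strategy: given the number `r` of boxes BoxBreaker just removed, the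
boxes removed so far and the items claimed so far, the set of (at most `2r`) items to
claim next. -/
abbrev BMStrategy (N M : ℕ) : Type :=
  ℕ → Finset (Fin N) → Finset (Fin N × Fin M) → Finset (Fin N × Fin M)

/-- On each of his turns BoxBreaker picks `r ∈ {1, …, q}` and removes `r` boxes still
on the board (he must remove at least one box as long as any remain). -/
def BBLegal (q : ℕ) {N M : ℕ} (β : BBStrategy N M) : Prop :=
  ∀ (R : Finset (Fin N)) (C : Finset (Fin N × Fin M)),
    (β R C).card ≤ q ∧ (∀ x ∈ β R C, x ∉ R) ∧
    ((Finset.univ \ R).Nonempty → (β R C).Nonempty)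

/-- On each of her turns BoxMaker claims up to `2r` as-yet-unclaimed items from boxes
remaining on the board, where `r` is the number of boxes BoxBreaker just removed. -/
def BMLegal {N M : ℕ} (μ : BMStrategy N M) : Prop :=
  ∀ (r : ℕ) (R : Finset (Fin N)) (C : Finset (Fin N × Fin M)),
    (μ r R C).card ≤ 2 * r ∧ ∀ x ∈ μ r R C, x.1 ∉ R ∧ x ∉ C

/-- The position (removed boxes, claimed items) after `n` full rounds of the
`(q, M, N)`-double-response box-game; BoxBreaker moves first in every round and
BoxMaker responds to his move. -/
def play {N M : ℕ} (β : BBStrategy N M) (μ : BMStrategy N M) :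
    ℕ → Finset (Fin N) × Finset (Fin N × Fin M)
  | 0 => (∅, ∅)
  | n + 1 =>
    let P := play β μ n
    let rm := β P.1 P.2
    let R := P.1 ∪ rm
    (R, P.2 ∪ μ rm.card R P.2)

end BoxGame

namespace BoxGame

variable {N M : ℕ}

/-- The number of items of the box `b` that belong to `C`. -/
def level (C : Finset (Fin N × Fin M)) (b : Fin N) : ℕ :=
  (Finset.univ.filter fun i : Fin M => (b, i) ∈ C).card

/-- The potential of a position: a remaining box with `j` claimed items has weight `2 ^ j`. -/
def weight (R : Finset (Fin N)) (C : Finset (Fin N × Fin M)) : ℕ :=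
  ∑ b ∈ Rᶜ, 2 ^ level C b

/-- Every remaining box has either `m` or `m + 1` claimed items. -/
def Balanced (m : ℕ) (R : Finset (Fin N)) (C : Finset (Fin N × Fin M)) : Prop :=
  ∀ b ∉ R, m ≤ level C b ∧ level C b ≤ m + 1

theorem Balanced.mono {m : ℕ} {R S : Finset (Fin N)} {C : Finset (Fin N × Fin M)}
    (h : Balanced m R C) (hRS : R ⊆ S) : Balanced m S C :=
  fun b hb => h b fun hR => hb (hRS hR)

theorem level_le (C : Finset (Fin N × Fin M)) (b : Fin N) : level C b ≤ M :=
  (Finset.card_filter_le _ _).trans_eq (by simp)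

theorem mem_of_level_eq {C : Finset (Fin N × Fin M)} {b : Fin N} (h : level C b = M)
    (i : Fin M) : (b, i) ∈ C := by
  have h' := (Finset.card_eq_iff_eq_univ _).1 (h.trans (Fintype.card_fin M).symm)
  have hi := Finset.mem_univ i
  rw [← h'] at hi
  exact (Finset.mem_filter.1 hi).2

theorem exists_notMem_of_level_lt {C : Finset (Fin N × Fin M)} {b : Fin N}
    (h : level C b < M) : ∃ i, (b, i) ∉ C := by
  by_contra! hall
  exact h.ne (by simp [level, hall])

theorem level_mono {C D : Finset (Fin N × Fin M)} (h : C ⊆ D) (b : Fin N) :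
    level C b ≤ level D b :=
  Finset.card_le_card fun i hi => by
    simp only [Finset.mem_filter] at hi ⊢
    exact ⟨hi.1, h hi.2⟩

theorem level_insert_self {C : Finset (Fin N × Fin M)} {b : Fin N} {i : Fin M}
    (h : (b, i) ∉ C) : level (insert (b, i) C) b = level C b + 1 := by
  rw [level, level, ← Finset.card_insert_of_notMem (a := i) (by simpa using h)]
  congr 1
  ext j
  simp

theorem level_insert_of_ne {C : Finset (Fin N × Fin M)} {a b : Fin N} (i : Fin M)
    (h : a ≠ b) : level (insert (b, i) C) a = level C a := by
  simp [level, h]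

theorem weight_insert {R : Finset (Fin N)} {C : Finset (Fin N × Fin M)} {b : Fin N}
    {i : Fin M} (hb : b ∉ R) (h : (b, i) ∉ C) :
    weight R (insert (b, i) C) = weight R C + 2 ^ level C b := by
  have hb' : b ∈ Rᶜ := Finset.mem_compl.2 hb
  have hsum : ∑ a ∈ Rᶜ.erase b, 2 ^ level (insert (b, i) C) a
      = ∑ a ∈ Rᶜ.erase b, 2 ^ level C a :=
    Finset.sum_congr rfl fun a ha => by
      rw [level_insert_of_ne i (Finset.ne_of_mem_erase ha)]
  rw [weight, weight, ← Finset.add_sum_erase _ _ hb', ← Finset.add_sum_erase _ _ hb',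
    hsum, level_insert_self h, pow_succ]
  ring

theorem Balanced.insert_of_minimal {m : ℕ} {R : Finset (Fin N)}
    {C : Finset (Fin N × Fin M)} (hbal : Balanced m R C) {b : Fin N} {i : Fin M}
    (hb : b ∉ R) (h : (b, i) ∉ C) (hmin : ∀ a ∉ R, level C b ≤ level C a) :
    Balanced (level C b) R (insert (b, i) C) := by
  intro a ha
  by_cases hab : a = b
  · subst hab
    rw [level_insert_self h]
    omega
  · rw [level_insert_of_ne i hab]
    have := hbal a ha
    have := hbal b hb
    have := hmin a ha
    omega

/-- Claiming `k` items one at a time, always in a least claimed remaining box. -/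
theorem exists_claims (R : Finset (Fin N)) (C : Finset (Fin N × Fin M)) (k : ℕ) :
    ∃ D : Finset (Fin N × Fin M), D.card ≤ k ∧ (∀ x ∈ D, x.1 ∉ R ∧ x ∉ C) ∧
      (Rᶜ.Nonempty → ∀ m, Balanced m R C →
        (∃ b ∉ R, level (C ∪ D) b = M) ∨
          ((∃ m', Balanced m' R (C ∪ D)) ∧
            weight R C + k * 2 ^ m ≤ weight R (C ∪ D))) := by
  induction k with
  | zero =>
    refine ⟨∅, le_rfl, by simp, fun _ m hm => Or.inr ⟨⟨m, by simpa using hm⟩, by simp⟩⟩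
  | succ k ih =>
    obtain ⟨D, hcard, hD, hbal⟩ := ih
    by_cases hfull : ∃ b ∉ R, level (C ∪ D) b = M
    · exact ⟨D, by omega, hD, fun _ _ _ => Or.inl hfull⟩
    by_cases hne : Rᶜ.Nonempty
    · obtain ⟨b, hbR, hmin⟩ := Finset.exists_min_image Rᶜ (level (C ∪ D)) hne
      rw [Finset.mem_compl] at hbR
      obtain ⟨i, hi⟩ := exists_notMem_of_level_lt
        ((level_le (C ∪ D) b).lt_of_ne fun h => hfull ⟨b, hbR, h⟩)
      refine ⟨insert (b, i) D, (Finset.card_insert_le _ _).trans (by omega), ?_, ?_⟩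
      · intro x hx
        rcases Finset.mem_insert.1 hx with rfl | hx
        · exact ⟨hbR, fun h => hi (Finset.mem_union_left _ h)⟩
        · exact hD x hx
      · intro _ m hm
        obtain ⟨⟨m', hm'⟩, hw⟩ := (hbal hne m hm).resolve_left hfull
        have hlev : m ≤ level (C ∪ D) b :=
          (hm b hbR).1.trans (level_mono Finset.subset_union_left b)
        have hpow : 2 ^ m ≤ 2 ^ level (C ∪ D) b := Nat.pow_le_pow_right two_pos hlev
        rw [Finset.union_insert]
        refine Or.inr ⟨⟨_, hm'.insert_of_minimal hbR hi
          fun a ha => hmin a (Finset.mem_compl.2 ha)⟩, ?_⟩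
        rw [weight_insert hbR hi, add_mul]
        omega
    · exact ⟨∅, by simp, by simp, fun h => absurd h hne⟩

theorem weight_le_weight_union_add {m : ℕ} {R : Finset (Fin N)}
    {C : Finset (Fin N × Fin M)} (hbal : Balanced m R C) {S : Finset (Fin N)}
    (hS : ∀ x ∈ S, x ∉ R) :
    weight R C ≤ weight (R ∪ S) C + 2 * S.card * 2 ^ m := by
  have hsub : S ⊆ Rᶜ := fun x hx => Finset.mem_compl.2 (hS x hx)
  have hcompl : (R ∪ S)ᶜ = Rᶜ \ S := by
    ext x
    simp
  have hle : ∑ b ∈ S, 2 ^ level C b ≤ S.card * 2 ^ (m + 1) := by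
    rw [← smul_eq_mul]
    exact Finset.sum_le_card_nsmul _ _ _ fun b hb =>
      Nat.pow_le_pow_right two_pos (hbal b (hS b hb)).2
  rw [weight, weight, hcompl, ← Finset.sum_sdiff hsub]
  calc _ ≤ _ := Nat.add_le_add_left hle _
    _ = _ := by ring

theorem weight_le_card_mul {R : Finset (Fin N)} {C : Finset (Fin N × Fin M)}
    (h : ∀ b ∉ R, level C b ≠ M) : weight R C ≤ Rᶜ.card * 2 ^ (M - 1) := by
  rw [← smul_eq_mul]
  refine Finset.sum_le_card_nsmul _ _ _ fun b hb => Nat.pow_le_pow_right two_pos ?_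
  have := (level_le C b).lt_of_ne (h b (Finset.mem_compl.1 hb))
  omega

end BoxGame

/-- **Lemma (BoxMaker wins the `(q, M, N)`-double-response box-game).**
Let `q, M, N` be positive integers with `N ≥ 4(q+2)^M`.  Then BoxMaker has a winning
strategy in the `(q, M, N)`-double-response box-game: she can guarantee that at some
point she has claimed all `M` items of some box that BoxBreaker has not removed. -/
theorem boxmaker_wins_double_response_box_game (q M N : ℕ) (hq : 1 ≤ q) (hM : 1 ≤ M)
    (hN : 4 * (q + 2) ^ M ≤ N) :
    ∃ μ : BoxGame.BMStrategy N M, BoxGame.BMLegal μ ∧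
      ∀ β : BoxGame.BBStrategy N M, BoxGame.BBLegal q β →
        ∃ (n : ℕ) (box : Fin N), box ∉ (BoxGame.play β μ n).1 ∧
          ∀ item : Fin M, (box, item) ∈ (BoxGame.play β μ n).2 := by
  classical
  choose D hcard hD hbal using
    fun (r : ℕ) (R : Finset (Fin N)) (C : Finset (Fin N × Fin M)) =>
      BoxGame.exists_claims R C (2 * r)
  refine ⟨D, fun r R C => ⟨hcard r R C, hD r R C⟩, fun β hβ => ?_⟩
  by_contra! hlose
  have hnotfull : ∀ n, ∀ b ∉ (BoxGame.play β D n).1,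
      BoxGame.level (BoxGame.play β D n).2 b ≠ M := by
    intro n b hb hM
    obtain ⟨i, hi⟩ := hlose n b hb
    exact hi (BoxGame.mem_of_level_eq hM i)
  have hlarge : q * 2 ^ (M - 1) < N := by
    have hpow : (q + 2) ^ M = (q + 2) ^ (M - 1) * (q + 2) := by
      rw [← pow_succ, Nat.sub_add_cancel hM]
    have hle : 2 ^ (M - 1) ≤ (q + 2) ^ (M - 1) := Nat.pow_le_pow_left (by omega) _
    have hpos : 0 < 2 ^ (M - 1) := by positivity
    nlinarith
  have hinv : ∀ n, (∃ m, BoxGame.Balanced m (BoxGame.play β D n).1 (BoxGame.play β D n).2) ∧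
      N ≤ BoxGame.weight (BoxGame.play β D n).1 (BoxGame.play β D n).2 ∧
      n ≤ (BoxGame.play β D n).1.card := by
    intro n
    induction n with
    | zero =>
      refine ⟨⟨0, fun b _ => ?_⟩, ?_, le_rfl⟩ <;>
        simp [BoxGame.play, BoxGame.level, BoxGame.weight]
    | succ n ih =>
      obtain ⟨⟨m, hm⟩, hw, hn⟩ := ih
      have hfull := hnotfull n
      have hfull' := hnotfull (n + 1)
      simp only [BoxGame.play] at hfull' ⊢
      generalize (BoxGame.play β D n).1 = R at *
      generalize (BoxGame.play β D n).2 = C at *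
      obtain ⟨hq', hS, hne⟩ := hβ R C
      generalize β R C = S at *
      have hcount : q < Rᶜ.card := lt_of_mul_lt_mul_right
        (hlarge.trans_le (hw.trans (BoxGame.weight_le_card_mul hfull))) (Nat.zero_le _)
      have hSne : S.Nonempty := hne (by
        rw [← Finset.compl_eq_univ_sdiff, ← Finset.card_pos]
        omega)
      have hunion : (R ∪ S).card = R.card + S.card :=
        Finset.card_union_of_disjoint (Finset.disjoint_right.2 hS)
      have hrem : (R ∪ S)ᶜ.Nonempty := by
        rw [← Finset.card_pos]
        rw [Finset.card_compl] at hcount ⊢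
        omega
      have hSpos := hSne.card_pos
      have hloss := BoxGame.weight_le_weight_union_add hm hS
      rcases hbal S.card (R ∪ S) C hrem m (hm.mono Finset.subset_union_left) with
        ⟨b, hb, hbM⟩ | ⟨hbal', hgain⟩
      · exact absurd hbM (hfull' b hb)
      · exact ⟨hbal', by omega, by omega⟩
  have hN' := (hinv (N + 1)).2.2
  have hcardle := Finset.card_le_univ (BoxGame.play β D (N + 1)).1
  rw [Fintype.card_fin] at hcardle
  omega
end
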